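/- For every C ⊆ {T, B, D} and every formula A of the tense language, if A is valid on all bi-relational frames in F_C, then A is provable in the nested sequent calculus NIK_tC. -/

import Mathlib

/-! # Core definitions: intuitionistic tense logic, bi-relational semantics,
nested sequents (seq-trees), the calculus NIK_tC, proof search, computation
trees, morphisms and blueprints. -/

/-- Formulae of the tense language `𝓛`:
`A ::= p | ⊥ | A ∨ A | A ∧ A | A ⊃ A | ◇A | ◆A | □A | ■A`. -/
inductive Fml : Type where
  | atom : ℕ → Fml
  | bot  : Fml
  | or   : Fml → Fml → Fml
  | and  : Fml → Fml → Fml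
  | imp  : Fml → Fml → Fml
  | dia  : Fml → Fml   -- ◇ (forward diamond)
  | bdia : Fml → Fml   -- ◆ (backward diamond)
  | box  : Fml → Fml   -- □ (forward box)
  | bbox : Fml → Fml   -- ■ (backward box)
  deriving DecidableEq

namespace Fml

/-- Modal depth of a formula. -/
def mdep : Fml → ℕ
  | atom _ => 0
  | bot => 0
  | or A B => max A.mdep B.mdep
  | and A B => max A.mdep B.mdep
  | imp A B => max A.mdep B.mdep
  | dia A => A.mdep + 1
  | bdia A => A.mdep + 1
  | box A => A.mdep + 1
  | bbox A => A.mdep + 1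

/-- The set of subformulae of a formula. -/
def subf : Fml → Finset Fml
  | atom p => {atom p}
  | bot => {bot}
  | or A B => insert (or A B) (A.subf ∪ B.subf)
  | and A B => insert (and A B) (A.subf ∪ B.subf)
  | imp A B => insert (imp A B) (A.subf ∪ B.subf)
  | dia A => insert (dia A) A.subf
  | bdia A => insert (bdia A) A.subf
  | box A => insert (box A) A.subf
  | bbox A => insert (bbox A) A.subf

/-- `⟨x⟩`: the diamond determined by the direction `x` (`true` = forward `◇`,
`false` = backward `◆`). -/
def diaF : Bool → Fml → Fml
  | true, A => dia A
  | false, A => bdia A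

/-- `[x]`: the box determined by the direction `x` (`true` = forward `□`,
`false` = backward `■`). -/
def boxF : Bool → Fml → Fml
  | true, A => box A
  | false, A => bbox A

end Fml

/-- A bi-relational model `M = (W, ≤, R, V)`: `≤` is a pre-order, `R` satisfies
the confluence conditions (F1) and (F2), and `V` is monotone along `≤`. -/
structure Model where
  W : Type
  le : W → W → Prop
  R : W → W → Prop
  val : W → ℕ → Prop
  nonempty : Nonempty W
  le_refl : ∀ w, le w w
  le_trans : ∀ {w u v}, le w u → le u v → le w v
  F1 : ∀ {w w' v}, le w w' → R w v → ∃ v', R w' v' ∧ le v v'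
  F2 : ∀ {w v v'}, R w v → le v v' → ∃ w', le w w' ∧ R w' v'
  mono : ∀ {w u p}, le w u → val w p → val u p

/-- The satisfaction relation `M, w ⊨ A`. -/
def Model.Sat (M : Model) : M.W → Fml → Prop
  | w, .atom p => M.val w p
  | _, .bot => False
  | w, .or A B => M.Sat w A ∨ M.Sat w B
  | w, .and A B => M.Sat w A ∧ M.Sat w B
  | w, .imp A B => ∀ u, M.le w u → M.Sat u A → M.Sat u B
  | w, .dia A => ∃ u, M.R w u ∧ M.Sat u A
  | w, .bdia A => ∃ u, M.R u w ∧ M.Sat u A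
  | w, .box A => ∀ u v, M.le w u → M.R u v → M.Sat v A
  | w, .bbox A => ∀ u v, M.le w u → M.R v u → M.Sat v A

/-- `M` is based on a frame in the class `F_C`, where the subset
`C ⊆ {T, B, D}` is encoded by the three Boolean flags `ct`, `cb`, `cd`:
`R` is reflexive if `T ∈ C`, symmetric if `B ∈ C`, and serial if `D ∈ C`. -/
def Model.InClass (M : Model) (ct cb cd : Bool) : Prop :=
  (ct = true → ∀ w, M.R w w) ∧
  (cb = true → ∀ w u, M.R w u → M.R u w) ∧
  (cd = true → ∀ w, ∃ u, M.R w u)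

/-- A Gentzen sequent `Γ ⊢ Δ` (finite sets of formulae). -/
abbrev GSeq : Type := Finset Fml × Finset Fml

/-- A seq-tree (equivalently, a nested sequent): a finite rooted tree whose
vertices (names, drawn from `ℕ`) are labelled with Gentzen sequents and whose
edges are labelled with a direction (`true` = forward `•`, `false` =
backward `◦`). -/
structure SeqTree where
  verts : Finset ℕ
  root : ℕ
  edges : Finset (ℕ × ℕ)
  elabel : ℕ → ℕ → Bool
  vlab : ℕ → GSeq
  root_mem : root ∈ verts
  edges_sub : ∀ e ∈ edges, e.1 ∈ verts ∧ e.2 ∈ verts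
  root_no_parent : ∀ u, (u, root) ∉ edges
  parent_unique : ∀ v ∈ verts, ∀ u u', (u, v) ∈ edges → (u', v) ∈ edges → u = u'
  connected : ∀ v ∈ verts, Relation.ReflTransGen (fun a b => (a, b) ∈ edges) root v

namespace SeqTree

/-- The antecedent (input formulae) of the `w`-component. -/
def ant (T : SeqTree) (w : ℕ) : Finset Fml := (T.vlab w).1

/-- The consequent (output formulae) of the `w`-component. -/
def suc (T : SeqTree) (w : ℕ) : Finset Fml := (T.vlab w).2

/-- `T.AtDepth w k`: the component `w` occurs at depth `k` in `T`. -/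
inductive AtDepth (T : SeqTree) : ℕ → ℕ → Prop where
  | root : T.AtDepth T.root 0
  | step {u v k} : T.AtDepth u k → (u, v) ∈ T.edges → T.AtDepth v (k + 1)

/-- `w` is a leaf of the seq-tree `T`. -/
def IsLeaf (T : SeqTree) (w : ℕ) : Prop := w ∈ T.verts ∧ ∀ u, (w, u) ∉ T.edges

/-- The modal depth of a nested sequent: the maximum over components `w` at
depth `k` of `(modal depth of a formula at w) + k`. -/
noncomputable def mdep (T : SeqTree) : ℕ :=
  sSup {n | ∃ w ∈ T.verts, ∃ k, T.AtDepth w k ∧ ∃ A ∈ T.ant w ∪ T.suc w, n = A.mdep + k}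

/-- `T ⊨ w ↠ₓ^C u`: the C-closure reachability relation of Definition 3.3,
with `C ⊆ {T,B}` encoded by the flags `ct`, `cb`. -/
def Reach (T : SeqTree) (ct cb : Bool) (x : Bool) (w u : ℕ) : Prop :=
  ((w, u) ∈ T.edges ∧ T.elabel w u = x) ∨
  ((u, w) ∈ T.edges ∧ T.elabel u w = !x) ∨
  (ct = true ∧ w = u ∧ w ∈ T.verts) ∨
  (cb = true ∧ (((w, u) ∈ T.edges ∧ T.elabel w u = !x) ∨
                ((u, w) ∈ T.edges ∧ T.elabel u w = x)))

/-- All formulae occurring in `T`, together with their subformulae. -/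
def subfs (T : SeqTree) : Finset Fml :=
  (T.verts.biUnion fun w => T.ant w ∪ T.suc w).biUnion Fml.subf

end SeqTree

/-- `M, ι ⊨ T`: satisfaction of a seq-tree on a model under an
`M`-interpretation `ι` (Definition 3.2): if every `•`-edge `(u,v)` satisfies
`ι(u) R ι(v)` and every `◦`-edge `(u,v)` satisfies `ι(v) R ι(u)`, then some
component `v` satisfies `M, ι(v) ⊨ ⋀Γ ⊃ ⋁Δ`. -/
def Model.SatSeq (M : Model) (T : SeqTree) (ι : ℕ → M.W) : Prop :=
  (∀ e ∈ T.edges, (T.elabel e.1 e.2 = true → M.R (ι e.1) (ι e.2)) ∧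
                  (T.elabel e.1 e.2 = false → M.R (ι e.2) (ι e.1))) →
  ∃ v ∈ T.verts, ∀ u, M.le (ι v) u →
    (∀ A ∈ T.ant v, M.Sat u A) → ∃ B ∈ T.suc v, M.Sat u B

/-- A default (trivial) seq-tree. -/
def SeqTree.triv : SeqTree where
  verts := {0}
  root := 0
  edges := ∅
  elabel := fun _ _ => true
  vlab := fun _ => (∅, ∅)
  root_mem := Finset.mem_singleton_self 0
  edges_sub := by intro e he; simp at he
  root_no_parent := by intro u h; simp at h
  parent_unique := by intro v _ u u' h; simp at h
  connected := by
    intro v hv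
    have hv0 : v = 0 := Finset.mem_singleton.mp hv
    subst hv0
    exact Relation.ReflTransGen.refl

instance : Inhabited SeqTree := ⟨SeqTree.triv⟩

/-- The nested sequent `⊢ A` consisting of a single component with empty
antecedent and consequent `{A}`. -/
def singleSeq (A : Fml) : SeqTree where
  verts := {0}
  root := 0
  edges := ∅
  elabel := fun _ _ => true
  vlab := fun _ => (∅, {A})
  root_mem := Finset.mem_singleton_self 0
  edges_sub := by intro e he; simp at he
  root_no_parent := by intro u h; simp at h
  parent_unique := by intro v _ u u' h; simp at h
  connected := by
    intro v hv
    have hv0 : v = 0 := Finset.mem_singleton.mp hv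
    subst hv0
    exact Relation.ReflTransGen.refl

/-! ## Morphisms between seq-trees -/

/-- A weak morphism between seq-trees: a root-preserving vertex map that
preserves edges and edge labels. -/
def WeakMorphism (T T' : SeqTree) (f : ℕ → ℕ) : Prop :=
  (∀ v ∈ T.verts, f v ∈ T'.verts) ∧
  f T.root = T'.root ∧
  ∀ u v, (u, v) ∈ T.edges → (f u, f v) ∈ T'.edges ∧ T.elabel u v = T'.elabel (f u) (f v)

/-- A strong morphism: a weak morphism additionally preserving vertex labels. -/
def StrongMorphism (T T' : SeqTree) (f : ℕ → ℕ) : Prop :=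
  WeakMorphism T T' f ∧ ∀ v ∈ T.verts, T.vlab v = T'.vlab (f v)

/-- Morphic equivalence `T ≃ T'`: strong morphisms exist in both directions. -/
def MorphEquiv (T T' : SeqTree) : Prop :=
  (∃ f, StrongMorphism T T' f) ∧ (∃ g, StrongMorphism T' T g)

/-- `T ∈ S(I)`: all vertex labels of `T` are built from subformulae of `I`. -/
def InS (I T : SeqTree) : Prop := ∀ w ∈ T.verts, T.ant w ∪ T.suc w ⊆ I.subfs

/-- `T` has depth at most `k`. -/
def DepthLE (T : SeqTree) (k : ℕ) : Prop := ∀ v n, T.AtDepth v n → n ≤ k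

/-! ## The rules of the calculus `NIK_tC` -/

/-- Two seq-trees share the same underlying shape (vertices, root, edges,
edge labels). -/
def sameShape (T T' : SeqTree) : Prop :=
  T'.verts = T.verts ∧ T'.root = T.root ∧ T'.edges = T.edges ∧ T'.elabel = T.elabel

/-- `T'` is `T` with the label of the component `w` replaced by `s`. -/
def updAt (T : SeqTree) (w : ℕ) (s : GSeq) (T' : SeqTree) : Prop :=
  sameShape T T' ∧ T'.vlab = Function.update T.vlab w s

/-- `T'` is `T` extended with a fresh child `u` of `w`, over an edge labelled
`x`, with component label `s`. -/
def extendAt (T : SeqTree) (w u : ℕ) (x : Bool) (s : GSeq) (T' : SeqTree) : Prop :=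
  w ∈ T.verts ∧ u ∉ T.verts ∧
  T'.verts = insert u T.verts ∧ T'.root = T.root ∧
  T'.edges = insert (w, u) T.edges ∧
  T'.elabel = (fun a b => if a = w ∧ b = u then x else T.elabel a b) ∧
  T'.vlab = Function.update T.vlab u s

/-- The rule `∨L` (conclusion `T`, premises `T1`, `T2`). -/
def OrLRule (T : SeqTree) (w : ℕ) (A B : Fml) (T1 T2 : SeqTree) : Prop :=
  ∃ Γ, w ∈ T.verts ∧ T.ant w = insert (A.or B) Γ ∧
    updAt T w (insert A Γ, T.suc w) T1 ∧ updAt T w (insert B Γ, T.suc w) T2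

/-- The rule `∨R`. -/
def OrRRule (T : SeqTree) (w : ℕ) (A B : Fml) (T' : SeqTree) : Prop :=
  ∃ Δ, w ∈ T.verts ∧ T.suc w = insert (A.or B) Δ ∧
    updAt T w (T.ant w, insert A (insert B Δ)) T'

/-- The rule `∧L`. -/
def AndLRule (T : SeqTree) (w : ℕ) (A B : Fml) (T' : SeqTree) : Prop :=
  ∃ Γ, w ∈ T.verts ∧ T.ant w = insert (A.and B) Γ ∧
    updAt T w (insert A (insert B Γ), T.suc w) T'

/-- The rule `∧R`. -/
def AndRRule (T : SeqTree) (w : ℕ) (A B : Fml) (T1 T2 : SeqTree) : Prop :=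
  ∃ Δ, w ∈ T.verts ∧ T.suc w = insert (A.and B) Δ ∧
    updAt T w (T.ant w, insert A Δ) T1 ∧ updAt T w (T.ant w, insert B Δ) T2

/-- The rule `⊃L`. -/
def ImpLRule (T : SeqTree) (w : ℕ) (A B : Fml) (T1 T2 : SeqTree) : Prop :=
  ∃ Γ, w ∈ T.verts ∧ T.ant w = insert (A.imp B) Γ ∧
    updAt T w (T.ant w, insert A (T.suc w)) T1 ∧ updAt T w (insert B Γ, T.suc w) T2

/-- The (non-invertible) rule `⊃R`: all consequents of all other components are
deleted, and `A ⊢ B` is adjoined at `w`. -/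
def ImpRRule (T : SeqTree) (w : ℕ) (A B : Fml) (T' : SeqTree) : Prop :=
  w ∈ T.verts ∧ A.imp B ∈ T.suc w ∧ sameShape T T' ∧
  (∀ v, v ≠ w → T'.vlab v = (T.ant v, ∅)) ∧
  T'.vlab w = (insert A (T.ant w), {B})

/-- The rule `⟨x⟩L`: a fresh `x`-child containing `A` in its antecedent is
created. -/
def DiaLRule (T : SeqTree) (w u : ℕ) (x : Bool) (A : Fml) (T' : SeqTree) : Prop :=
  ∃ Γ, w ∈ T.verts ∧ u ∉ T.verts ∧ T.ant w = insert (Fml.diaF x A) Γ ∧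
    T'.verts = insert u T.verts ∧ T'.root = T.root ∧
    T'.edges = insert (w, u) T.edges ∧
    T'.elabel = (fun a b => if a = w ∧ b = u then x else T.elabel a b) ∧
    T'.vlab = fun v => if v = u then ({A}, ∅) else if v = w then (Γ, T.suc w) else T.vlab v

/-- The propagation rule `⟨x⟩R`, restricted by the C-closure reachability
relation `w ↠ₓ^C u`. -/
def DiaRRule (ct cb : Bool) (T : SeqTree) (w u : ℕ) (x : Bool) (A : Fml) (T' : SeqTree) : Prop :=
  w ∈ T.verts ∧ u ∈ T.verts ∧ Fml.diaF x A ∈ T.suc w ∧ T.Reach ct cb x w u ∧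
  updAt T u (T.ant u, insert A (T.suc u)) T'

/-- The propagation rule `[x]L`, restricted by `w ↠ₓ^C u`. -/
def BoxLRule (ct cb : Bool) (T : SeqTree) (w u : ℕ) (x : Bool) (A : Fml) (T' : SeqTree) : Prop :=
  w ∈ T.verts ∧ u ∈ T.verts ∧ Fml.boxF x A ∈ T.ant w ∧ T.Reach ct cb x w u ∧
  updAt T u (insert A (T.ant u), T.suc u) T'

/-- The (non-invertible) rule `[x]R`: all consequents are deleted and a fresh
`x`-child `⊢ A` is created. -/
def BoxRRule (T : SeqTree) (w u : ℕ) (x : Bool) (A : Fml) (T' : SeqTree) : Prop :=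
  w ∈ T.verts ∧ u ∉ T.verts ∧ Fml.boxF x A ∈ T.suc w ∧
  T'.verts = insert u T.verts ∧ T'.root = T.root ∧
  T'.edges = insert (w, u) T.edges ∧
  T'.elabel = (fun a b => if a = w ∧ b = u then x else T.elabel a b) ∧
  (∀ v ∈ T.verts, T'.vlab v = (T.ant v, ∅)) ∧
  T'.vlab u = (∅, {A})

/-- The rule `d`: an empty fresh `•`-child is adjoined. -/
def DRule (T : SeqTree) (w u : ℕ) (T' : SeqTree) : Prop :=
  extendAt T w u true (∅, ∅) T'

/-- Provability in the nested sequent calculus `NIK_tC`, where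
`C ⊆ {T, B, D}` is encoded by the Boolean flags `ct`, `cb`, `cd`
(the rule `d` belongs to the calculus iff `D ∈ C`). -/
inductive Prov (ct cb cd : Bool) : SeqTree → Prop where
  | id {T : SeqTree} {w p} : w ∈ T.verts → Fml.atom p ∈ T.ant w → Fml.atom p ∈ T.suc w →
      Prov ct cb cd T
  | botL {T : SeqTree} {w} : w ∈ T.verts → Fml.bot ∈ T.ant w → Prov ct cb cd T
  | orL {T w A B T1 T2} : OrLRule T w A B T1 T2 → Prov ct cb cd T1 → Prov ct cb cd T2 →
      Prov ct cb cd T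
  | orR {T w A B T'} : OrRRule T w A B T' → Prov ct cb cd T' → Prov ct cb cd T
  | andL {T w A B T'} : AndLRule T w A B T' → Prov ct cb cd T' → Prov ct cb cd T
  | andR {T w A B T1 T2} : AndRRule T w A B T1 T2 → Prov ct cb cd T1 → Prov ct cb cd T2 →
      Prov ct cb cd T
  | impL {T w A B T1 T2} : ImpLRule T w A B T1 T2 → Prov ct cb cd T1 → Prov ct cb cd T2 →
      Prov ct cb cd T
  | impR {T w A B T'} : ImpRRule T w A B T' → Prov ct cb cd T' → Prov ct cb cd T
  | diaL {T w u x A T'} : DiaLRule T w u x A T' → Prov ct cb cd T' → Prov ct cb cd T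
  | diaR {T w u x A T'} : DiaRRule ct cb T w u x A T' → Prov ct cb cd T' → Prov ct cb cd T
  | boxL {T w u x A T'} : BoxLRule ct cb T w u x A T' → Prov ct cb cd T' → Prov ct cb cd T
  | boxR {T w u x A T'} : BoxRRule T w u x A T' → Prov ct cb cd T' → Prov ct cb cd T
  | d {T w u T'} : cd = true → DRule T w u T' → Prov ct cb cd T' → Prov ct cb cd T

/-! ## Saturation, stability, initial sequents -/

/-- An initial sequent: some formula occurs among the input and output
formulae, or `⊥` occurs among the input formulae (lines 1–3 of `Prove_C`). -/
def InitialSeq (T : SeqTree) : Prop :=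
  (∃ A : Fml, (∃ w ∈ T.verts, A ∈ T.ant w) ∧ (∃ u ∈ T.verts, A ∈ T.suc u)) ∨
  (∃ w ∈ T.verts, Fml.bot ∈ T.ant w)

/-- `C`-saturation of a seq-tree (Definition 4.2); `m` is the modal depth of
the input sequent `I` of the proof search (used by condition `(d)`). -/
def Saturated (ct cb cd : Bool) (m : ℕ) (T : SeqTree) : Prop :=
  ∀ w ∈ T.verts,
    (∀ A : Fml, ¬ (A ∈ T.ant w ∧ A ∈ T.suc w)) ∧
    Fml.bot ∉ T.ant w ∧
    (∀ A B, A.or B ∈ T.ant w → A ∈ T.ant w ∨ B ∈ T.ant w) ∧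
    (∀ A B, A.or B ∈ T.suc w → A ∈ T.suc w ∧ B ∈ T.suc w) ∧
    (∀ A B, A.and B ∈ T.ant w → A ∈ T.ant w ∧ B ∈ T.ant w) ∧
    (∀ A B, A.and B ∈ T.suc w → A ∈ T.suc w ∨ B ∈ T.suc w) ∧
    (∀ A B, A.imp B ∈ T.ant w → A ∈ T.suc w ∨ B ∈ T.ant w) ∧
    (∀ x A, Fml.diaF x A ∈ T.ant w →
      ∃ u, (w, u) ∈ T.edges ∧ T.elabel w u = x ∧ A ∈ T.ant u) ∧
    (∀ x A u, Fml.diaF x A ∈ T.suc w → T.Reach ct cb x w u → A ∈ T.suc u) ∧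
    (∀ x A u, Fml.boxF x A ∈ T.ant w → T.Reach ct cb x w u → A ∈ T.ant u) ∧
    (cd = true → ∀ k, T.AtDepth w k → k ≤ m →
      ∃ u, (w, u) ∈ T.edges ∧ T.elabel w u = true)

/-- A stable seq-tree: saturated, with no output implications or boxes. -/
def StableSeq (ct cb cd : Bool) (m : ℕ) (T : SeqTree) : Prop :=
  Saturated ct cb cd m T ∧
  ∀ w ∈ T.verts, (∀ A B : Fml, A.imp B ∉ T.suc w) ∧
    (∀ A : Fml, Fml.box A ∉ T.suc w) ∧ (∀ A : Fml, Fml.bbox A ∉ T.suc w)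

/-- `T` is a repeat relative to the list `hist` of its ancestors: it is
saturated and admits a strong morphism to some ancestor (its companion). -/
def Repeats (ct cb cd : Bool) (m : ℕ) (hist : List SeqTree) (T : SeqTree) : Prop :=
  Saturated ct cb cd m T ∧ ∃ H ∈ hist, ∃ f, StrongMorphism T H f

/-- Proof search halts at `T` (relative to the ancestors `hist`): `T` is
initial, stable, or a repeat. -/
def Halted (ct cb cd : Bool) (m : ℕ) (hist : List SeqTree) (T : SeqTree) : Prop :=
  InitialSeq T ∨ StableSeq ct cb cd m T ∨ Repeats ct cb cd m hist T

/-! ## The proof-search steps of `Prove_C` -/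

/-- Adjoin `A` to the antecedent of the `w`-component (the operation
`G ◁_w (A ⊢)`). -/
def addAnt (T : SeqTree) (w : ℕ) (A : Fml) (T' : SeqTree) : Prop :=
  w ∈ T.verts ∧ updAt T w (insert A (T.ant w), T.suc w) T'

/-- Adjoin `A` to the consequent of the `w`-component (the operation
`G ◁_w (⊢ A)`). -/
def addSuc (T : SeqTree) (w : ℕ) (A : Fml) (T' : SeqTree) : Prop :=
  w ∈ T.verts ∧ updAt T w (T.ant w, insert A (T.suc w)) T'

/-- One (bottom-up, non-redundant) rule application performed by the
proof-search algorithm `Prove_C` on input of modal depth `m`, producing the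
premise `T'` from `T`.  The disjunctive-branching rule `db` (simultaneous
`⊃R`/`[x]R` applications) is applied only to saturated sequents. -/
def AlgStep (ct cb cd : Bool) (m : ℕ) (T T' : SeqTree) : Prop :=
  -- ∨L
  (∃ w A B, w ∈ T.verts ∧ Fml.or A B ∈ T.ant w ∧ A ∉ T.ant w ∧ B ∉ T.ant w ∧
    (addAnt T w A T' ∨ addAnt T w B T')) ∨
  -- ∨R
  (∃ w A B, w ∈ T.verts ∧ Fml.or A B ∈ T.suc w ∧ ¬ (A ∈ T.suc w ∧ B ∈ T.suc w) ∧
    updAt T w (T.ant w, insert A (insert B (T.suc w))) T') ∨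
  -- ∧L
  (∃ w A B, w ∈ T.verts ∧ Fml.and A B ∈ T.ant w ∧ ¬ (A ∈ T.ant w ∧ B ∈ T.ant w) ∧
    updAt T w (insert A (insert B (T.ant w)), T.suc w) T') ∨
  -- ∧R
  (∃ w A B, w ∈ T.verts ∧ Fml.and A B ∈ T.suc w ∧ A ∉ T.suc w ∧ B ∉ T.suc w ∧
    (addSuc T w A T' ∨ addSuc T w B T')) ∨
  -- ⊃L
  (∃ w A B, w ∈ T.verts ∧ Fml.imp A B ∈ T.ant w ∧ A ∉ T.suc w ∧ B ∉ T.ant w ∧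
    (addSuc T w A T' ∨ addAnt T w B T')) ∨
  -- ⟨x⟩L
  (∃ w u x A, w ∈ T.verts ∧ Fml.diaF x A ∈ T.ant w ∧
    (¬ ∃ v, T.Reach ct cb x w v ∧ A ∈ T.ant v) ∧
    extendAt T w u x ({A}, ∅) T') ∨
  -- ⟨x⟩R
  (∃ w u x A, w ∈ T.verts ∧ Fml.diaF x A ∈ T.suc w ∧ T.Reach ct cb x w u ∧
    A ∉ T.suc u ∧ addSuc T u A T') ∨
  -- [x]L
  (∃ w u x A, w ∈ T.verts ∧ Fml.boxF x A ∈ T.ant w ∧ T.Reach ct cb x w u ∧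
    A ∉ T.ant u ∧ addAnt T u A T') ∨
  -- d
  (cd = true ∧ ∃ w u k, T.AtDepth w k ∧ k ≤ m ∧
    (¬ ∃ v, (w, v) ∈ T.edges ∧ T.elabel w v = true) ∧ extendAt T w u true (∅, ∅) T') ∨
  -- db (simultaneous ⊃R / [x]R applications on saturated sequents)
  (Saturated ct cb cd m T ∧
    ((∃ w A B, ImpRRule T w A B T') ∨ (∃ w u x A, BoxRRule T w u x A T')))

/-- `T` occurs in the computation tree `ct(I)` generated by `Prove_C(I)`:
it is obtainable from `I` by a sequence of proof-search steps. -/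
def InCT (ct cb cd : Bool) (I T : SeqTree) : Prop :=
  Relation.ReflTransGen (AlgStep ct cb cd I.mdep) I T

/-! ## Computation trees -/

/-- A node of a computation tree: a seq-tree, the Boolean value returned by the
corresponding recursive call of `Prove_C`, and the list of child nodes. -/
inductive RTree : Type where
  | node : SeqTree → Bool → List RTree → RTree

/-- The seq-tree at the root of a computation tree. -/
def RTree.seq : RTree → SeqTree
  | .node T _ _ => T

/-- The Boolean label at the root of a computation tree. -/
def RTree.val : RTree → Bool
  | .node _ b _ => b

/-- The children of the root of a computation tree. -/
def RTree.kids : RTree → List RTree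
  | .node _ _ ts => ts

/-- Proof search is still running at `T` (none of the halting conditions of
lines 1–6 of `Prove_C` applies). -/
def Running (ct cb cd : Bool) (m : ℕ) (hist : List SeqTree) (T : SeqTree) : Prop :=
  ¬ InitialSeq T ∧ ¬ StableSeq ct cb cd m T ∧ ¬ Repeats ct cb cd m hist T

/-- `ValidCT ct cb cd m hist t`: the labelled tree `t` is a computation tree
generated by a run of `Prove_C` (with ancestor list `hist`): each parent is the
conclusion of a rule of `(NIK_tC ∖ {⊃R, [x]R}) ∪ {db}` with its children the
premises, halting nodes are labelled as the algorithm prescribes, conjunctive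
branching takes the conjunction of the children's values, and the disjunctive
branching rule `db` (applied to saturated sequents, with one premise for each
output implication and each output box) takes their disjunction. -/
inductive ValidCT (ct cb cd : Bool) (m : ℕ) : List SeqTree → RTree → Prop where
  | initial {hist T} : InitialSeq T → ValidCT ct cb cd m hist (.node T true [])
  | stable {hist T} : ¬ InitialSeq T → StableSeq ct cb cd m T →
      ValidCT ct cb cd m hist (.node T false [])
  | rep {hist T} : ¬ InitialSeq T → Repeats ct cb cd m hist T →
      ValidCT ct cb cd m hist (.node T false [])
  | orL {hist T w A B t1 t2} : Running ct cb cd m hist T →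
      w ∈ T.verts → Fml.or A B ∈ T.ant w → A ∉ T.ant w → B ∉ T.ant w →
      addAnt T w A t1.seq → addAnt T w B t2.seq →
      ValidCT ct cb cd m (T :: hist) t1 → ValidCT ct cb cd m (T :: hist) t2 →
      ValidCT ct cb cd m hist (.node T (t1.val && t2.val) [t1, t2])
  | orR {hist T w A B t} : Running ct cb cd m hist T →
      w ∈ T.verts → Fml.or A B ∈ T.suc w → ¬ (A ∈ T.suc w ∧ B ∈ T.suc w) →
      updAt T w (T.ant w, insert A (insert B (T.suc w))) t.seq →
      ValidCT ct cb cd m (T :: hist) t →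
      ValidCT ct cb cd m hist (.node T t.val [t])
  | andL {hist T w A B t} : Running ct cb cd m hist T →
      w ∈ T.verts → Fml.and A B ∈ T.ant w → ¬ (A ∈ T.ant w ∧ B ∈ T.ant w) →
      updAt T w (insert A (insert B (T.ant w)), T.suc w) t.seq →
      ValidCT ct cb cd m (T :: hist) t →
      ValidCT ct cb cd m hist (.node T t.val [t])
  | andR {hist T w A B t1 t2} : Running ct cb cd m hist T →
      w ∈ T.verts → Fml.and A B ∈ T.suc w → A ∉ T.suc w → B ∉ T.suc w →
      addSuc T w A t1.seq → addSuc T w B t2.seq →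
      ValidCT ct cb cd m (T :: hist) t1 → ValidCT ct cb cd m (T :: hist) t2 →
      ValidCT ct cb cd m hist (.node T (t1.val && t2.val) [t1, t2])
  | impL {hist T w A B t1 t2} : Running ct cb cd m hist T →
      w ∈ T.verts → Fml.imp A B ∈ T.ant w → A ∉ T.suc w → B ∉ T.ant w →
      addSuc T w A t1.seq → addAnt T w B t2.seq →
      ValidCT ct cb cd m (T :: hist) t1 → ValidCT ct cb cd m (T :: hist) t2 →
      ValidCT ct cb cd m hist (.node T (t1.val && t2.val) [t1, t2])
  | diaL {hist T w u x A t} : Running ct cb cd m hist T →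
      w ∈ T.verts → Fml.diaF x A ∈ T.ant w →
      (¬ ∃ v, T.Reach ct cb x w v ∧ A ∈ T.ant v) →
      extendAt T w u x ({A}, ∅) t.seq →
      ValidCT ct cb cd m (T :: hist) t →
      ValidCT ct cb cd m hist (.node T t.val [t])
  | diaR {hist T w u x A t} : Running ct cb cd m hist T →
      w ∈ T.verts → Fml.diaF x A ∈ T.suc w → T.Reach ct cb x w u → A ∉ T.suc u →
      addSuc T u A t.seq →
      ValidCT ct cb cd m (T :: hist) t →
      ValidCT ct cb cd m hist (.node T t.val [t])
  | boxL {hist T w u x A t} : Running ct cb cd m hist T →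
      w ∈ T.verts → Fml.boxF x A ∈ T.ant w → T.Reach ct cb x w u → A ∉ T.ant u →
      addAnt T u A t.seq →
      ValidCT ct cb cd m (T :: hist) t →
      ValidCT ct cb cd m hist (.node T t.val [t])
  | d {hist T w u k t} : Running ct cb cd m hist T →
      cd = true → T.AtDepth w k → k ≤ m →
      (¬ ∃ v, (w, v) ∈ T.edges ∧ T.elabel w v = true) →
      extendAt T w u true (∅, ∅) t.seq →
      ValidCT ct cb cd m (T :: hist) t →
      ValidCT ct cb cd m hist (.node T t.val [t])
  | db {hist T ts} : Running ct cb cd m hist T →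
      Saturated ct cb cd m T →
      (∀ t ∈ ts, ValidCT ct cb cd m (T :: hist) t) →
      (∀ t ∈ ts, (∃ w A B, ImpRRule T w A B t.seq) ∨ (∃ w u x A, BoxRRule T w u x A t.seq)) →
      (∀ w ∈ T.verts, ∀ A B, Fml.imp A B ∈ T.suc w → ∃ t ∈ ts, ImpRRule T w A B t.seq) →
      (∀ w ∈ T.verts, ∀ x A, Fml.boxF x A ∈ T.suc w → ∃ t ∈ ts, ∃ u, BoxRRule T w u x A t.seq) →
      ValidCT ct cb cd m hist (.node T (ts.any RTree.val) ts)

/-! ## Blueprints and the extracted counter-model -/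

/-- The subtree of a computation tree at the address `π` (a list of child
positions); addresses play the role of the positions of the enumeration `η`. -/
def RTree.at? : RTree → List ℕ → Option RTree
  | t, [] => some t
  | t, i :: π =>
    match t.kids[i]? with
    | some t' => t'.at? π
    | none => none

/-- The seq-tree at the address `π` of a computation tree. -/
def RTree.seqAt (t : RTree) (π : List ℕ) : SeqTree :=
  (t.at? π).elim default RTree.seq

/-- The node at address `π` exists and every node on the path from the root to
it (inclusive) is labelled `F`; these are the nodes of the blueprint `bp(I)`. -/
def FNode (t : RTree) (π : List ℕ) : Prop :=
  ∀ σ, σ <+: π → ∃ s, t.at? σ = some s ∧ s.val = false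

/-- Membership in the set `S` of the blueprint: an `F`-reachable node whose
seq-tree is `C`-saturated (an η-renamed saturated seq-tree of `bp(I)`;
the vertex `w` of the seq-tree at address `π` represents the renamed
component `(w, π)`). -/
def InSsat (ct cb cd : Bool) (m : ℕ) (t : RTree) (π : List ℕ) : Prop :=
  FNode t π ∧ Saturated ct cb cd m (t.seqAt π)

/-- The node at address `π` is a repeat of the blueprint: an `F`-path leaf of
the computation tree that is saturated but not stable. -/
def RepNode (ct cb cd : Bool) (m : ℕ) (t : RTree) (π : List ℕ) : Prop :=
  FNode t π ∧ (∃ s, t.at? π = some s ∧ s.kids = []) ∧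
  Saturated ct cb cd m (t.seqAt π) ∧ ¬ StableSeq ct cb cd m (t.seqAt π)

/-- `(gc, gf)` is a family `γ⃗` of strong morphisms mapping each repeat of the
blueprint to its companion: a proper ancestor belonging to `S` (C-saturated,
on an `F`-path) together with a strong morphism onto it. -/
def GammaOK (ct cb cd : Bool) (m : ℕ) (t : RTree)
    (gc : List ℕ → List ℕ) (gf : List ℕ → ℕ → ℕ) : Prop :=
  ∀ π, RepNode ct cb cd m t π →
    gc π <+: π ∧ gc π ≠ π ∧ InSsat ct cb cd m t (gc π) ∧
    StrongMorphism (t.seqAt π) (t.seqAt (gc π)) (gf π)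

/-- One step of a morphic sequence: either a natural morphism between members
of `S` related by `≺_bp*` (mapping `(w, π)` to `(w, π')`), or a strong morphism
of the family `γ⃗` mapping a repeat to its companion. -/
inductive MStep (ct cb cd : Bool) (m : ℕ) (t : RTree)
    (gc : List ℕ → List ℕ) (gf : List ℕ → ℕ → ℕ) :
    (ℕ × List ℕ) → (ℕ × List ℕ) → Prop where
  | nat {w : ℕ} {π π' : List ℕ} :
      InSsat ct cb cd m t π → InSsat ct cb cd m t π' → π <+: π' →
      w ∈ (t.seqAt π).verts →
      MStep ct cb cd m t gc gf (w, π) (w, π')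
  | rep {w : ℕ} {π : List ℕ} :
      RepNode ct cb cd m t π → w ∈ (t.seqAt π).verts →
      MStep ct cb cd m t gc gf (w, π) (gf π w, gc π)

/-- A morphic sequence `(w, π) ⟶_σ (u, π')` in the blueprint. -/
def MSeq (ct cb cd : Bool) (m : ℕ) (t : RTree)
    (gc : List ℕ → List ℕ) (gf : List ℕ → ℕ → ℕ) :
    (ℕ × List ℕ) → (ℕ × List ℕ) → Prop :=
  Relation.ReflTransGen (MStep ct cb cd m t gc gf)

/-- The set `W` of worlds of the extracted model: the (renamed) components of
the saturated seq-trees of the blueprint. -/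
def Worlds (ct cb cd : Bool) (m : ℕ) (t : RTree) : Set (ℕ × List ℕ) :=
  {a | InSsat ct cb cd m t a.2 ∧ a.1 ∈ (t.seqAt a.2).verts}

/-- The modal relation `R` of the extracted model: induced by the C-closure
reachability relation inside each saturated seq-tree, together with self-loops
at components of depth `m + 1` when `D ∈ C`. -/
def bpR (ct cb cd : Bool) (m : ℕ) (t : RTree) :
    (ℕ × List ℕ) → (ℕ × List ℕ) → Prop :=
  fun a b =>
    (a.2 = b.2 ∧ InSsat ct cb cd m t a.2 ∧ (t.seqAt a.2).Reach ct cb true a.1 b.1) ∨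
    (cd = true ∧ a = b ∧ InSsat ct cb cd m t a.2 ∧ (t.seqAt a.2).AtDepth a.1 (m + 1))

/-- The valuation `V` of the extracted model: `(w, π) ∈ V(p)` iff `p` occurs in
the antecedent of the component `(w, π)`. -/
def bpVal (ct cb cd : Bool) (m : ℕ) (t : RTree) : (ℕ × List ℕ) → ℕ → Prop :=
  fun a p => InSsat ct cb cd m t a.2 ∧ Fml.atom p ∈ (t.seqAt a.2).ant a.1

/-- Satisfaction over raw frame data (the same clauses as `Model.Sat`). -/
def SatR {W : Type} (le R : W → W → Prop) (val : W → ℕ → Prop) : W → Fml → Prop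
  | w, .atom p => val w p
  | _, .bot => False
  | w, .or A B => SatR le R val w A ∨ SatR le R val w B
  | w, .and A B => SatR le R val w A ∧ SatR le R val w B
  | w, .imp A B => ∀ u, le w u → SatR le R val u A → SatR le R val u B
  | w, .dia A => ∃ u, R w u ∧ SatR le R val u A
  | w, .bdia A => ∃ u, R u w ∧ SatR le R val u A
  | w, .box A => ∀ u v, le w u → R u v → SatR le R val v A
  | w, .bbox A => ∀ u v, le w u → R v u → SatR le R val v A

/-! ## Completeness: the canonical model of saturated unprovable seq-trees -/

namespace Fml

theorem self_mem_subf (A : Fml) : A ∈ A.subf := by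
  cases A <;> simp [subf]

theorem subf_subset {A B : Fml} (h : B ∈ A.subf) : B.subf ⊆ A.subf := by
  induction A with
  | atom p => simp only [subf, Finset.mem_singleton] at h; subst h; rfl
  | bot => simp only [subf, Finset.mem_singleton] at h; subst h; rfl
  | or A₁ A₂ ih₁ ih₂ | and A₁ A₂ ih₁ ih₂ | imp A₁ A₂ ih₁ ih₂ =>
    simp only [subf, Finset.mem_insert, Finset.mem_union] at h
    rcases h with rfl | h | h
    · rfl
    · exact fun C hC => by simp [subf, ih₁ h hC]
    · exact fun C hC => by simp [subf, ih₂ h hC]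
  | dia A ih | bdia A ih | box A ih | bbox A ih =>
    simp only [subf, Finset.mem_insert] at h
    rcases h with rfl | h
    · rfl
    · exact fun C hC => by simp [subf, ih h hC]

theorem mdep_diaF (x : Bool) (A : Fml) : (diaF x A).mdep = A.mdep + 1 := by
  cases x <;> rfl

theorem mdep_boxF (x : Bool) (A : Fml) : (boxF x A).mdep = A.mdep + 1 := by
  cases x <;> rfl

theorem mem_subf_diaF (x : Bool) (A : Fml) : A ∈ (diaF x A).subf := by
  cases x <;> simp [diaF, subf, self_mem_subf]

theorem mem_subf_boxF (x : Bool) (A : Fml) : A ∈ (boxF x A).subf := by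
  cases x <;> simp [boxF, subf, self_mem_subf]

end Fml

namespace SeqTree

/-- Replace all labels of a seq-tree. -/
def relabel (T : SeqTree) (l : ℕ → GSeq) : SeqTree := { T with vlab := l }

/-- Adjoin a fresh child `u` of `w` and replace all labels. -/
def addChild (T : SeqTree) (w u : ℕ) (x : Bool) (hw : w ∈ T.verts) (hu : u ∉ T.verts)
    (l : ℕ → GSeq) : SeqTree where
  verts := insert u T.verts
  root := T.root
  edges := insert (w, u) T.edges
  elabel := fun a b => if a = w ∧ b = u then x else T.elabel a b
  vlab := l
  root_mem := Finset.mem_insert_of_mem T.root_mem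
  edges_sub := by
    intro e he
    rcases Finset.mem_insert.1 he with rfl | he
    · simp [hw]
    · have := T.edges_sub e he
      simp [this.1, this.2]
  root_no_parent := by
    intro v hv
    rcases Finset.mem_insert.1 hv with hv | hv
    · obtain ⟨-, rfl⟩ := Prod.mk.inj hv
      exact hu T.root_mem
    · exact T.root_no_parent v hv
  parent_unique := by
    intro v _ a b ha hb
    simp only [Finset.mem_insert, Prod.mk.injEq] at ha hb
    rcases ha with ⟨rfl, rfl⟩ | ha <;> rcases hb with ⟨rfl, h⟩ | hb
    · rfl
    · exact absurd (T.edges_sub _ hb).2 hu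
    · exact absurd (T.edges_sub _ ha).2 (h ▸ hu)
    · exact T.parent_unique v (T.edges_sub _ ha).2 a b ha hb
  connected := by
    have mono : ∀ v ∈ T.verts,
        Relation.ReflTransGen (fun a b => (a, b) ∈ insert (w, u) T.edges) T.root v :=
      fun v hv => Relation.ReflTransGen.mono
        (r := fun a b => (a, b) ∈ T.edges) (fun _ _ h => Finset.mem_insert_of_mem h) _ _
        (T.connected v hv)
    intro v hv
    rcases Finset.mem_insert.1 hv with rfl | hv
    · exact (mono w hw).tail (Finset.mem_insert_self _ _)
    · exact mono v hv

theorem Reach.mem_right {T : SeqTree} {ct cb x : Bool} {w u : ℕ} (h : T.Reach ct cb x w u) :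
    u ∈ T.verts := by
  rcases h with h | h | h | ⟨-, h | h⟩
  · exact (T.edges_sub _ h.1).2
  · exact (T.edges_sub _ h.1).1
  · exact h.2.1 ▸ h.2.2
  · exact (T.edges_sub _ h.1).2
  · exact (T.edges_sub _ h.1).1

theorem Reach.mem_left {T : SeqTree} {ct cb x : Bool} {w u : ℕ} (h : T.Reach ct cb x w u) :
    w ∈ T.verts := by
  rcases h with h | h | h | ⟨-, h | h⟩
  · exact (T.edges_sub _ h.1).1
  · exact (T.edges_sub _ h.1).2
  · exact h.2.2
  · exact (T.edges_sub _ h.1).1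
  · exact (T.edges_sub _ h.1).2

theorem Reach.swap {T : SeqTree} {ct cb x : Bool} {w u : ℕ} (h : T.Reach ct cb x w u) :
    T.Reach ct cb (!x) u w := by
  rcases h with h | h | ⟨h₁, h₂, h₃⟩ | ⟨h₁, h | h⟩
  · exact .inr (.inl ⟨h.1, by simp [h.2]⟩)
  · exact .inl h
  · exact .inr (.inr (.inl ⟨h₁, h₂.symm, h₂ ▸ h₃⟩))
  · exact .inr (.inr (.inr ⟨h₁, .inr h⟩))
  · exact .inr (.inr (.inr ⟨h₁, .inl ⟨h.1, by simp [h.2]⟩⟩))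

theorem Reach.symm {T : SeqTree} {ct x : Bool} {w u : ℕ} (h : T.Reach ct true x w u) :
    T.Reach ct true x u w := by
  rcases h with h | h | ⟨h₁, h₂, h₃⟩ | ⟨-, h | h⟩
  · exact .inr (.inr (.inr ⟨rfl, .inr h⟩))
  · exact .inr (.inr (.inr ⟨rfl, .inl h⟩))
  · exact .inr (.inr (.inl ⟨h₁, h₂.symm, h₂ ▸ h₃⟩))
  · exact .inr (.inl h)
  · exact .inl h

/-- The formulae of `s` belong to `S` and have modal depth at most `m - k`. -/
def Fits (S : Finset Fml) (m k : ℕ) (s : GSeq) : Prop :=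
  ∀ A ∈ s.1 ∪ s.2, A ∈ S ∧ A.mdep + k ≤ m

/-- `dep` is a depth function of `T`, bounded by `m`, and all labels fit. -/
structure Graded (S : Finset Fml) (m : ℕ) (T : SeqTree) (dep : ℕ → ℕ) : Prop where
  edge : ∀ {u v}, (u, v) ∈ T.edges → dep v = dep u + 1
  le : ∀ v ∈ T.verts, dep v ≤ m
  fits : ∀ v ∈ T.verts, Fits S m (dep v) (T.vlab v)

/-- `T` is a subtree of `T'`, with smaller antecedents. -/
structure Sub (T : SeqTree) (dep : ℕ → ℕ) (T' : SeqTree) (dep' : ℕ → ℕ) : Prop where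
  verts : T.verts ⊆ T'.verts
  edges : T.edges ⊆ T'.edges
  elabel : ∀ {u v}, (u, v) ∈ T.edges → T'.elabel u v = T.elabel u v
  dep : ∀ v ∈ T.verts, dep' v = dep v
  ant : ∀ v ∈ T.verts, T.ant v ⊆ T'.ant v

theorem Sub.refl (T : SeqTree) (dep : ℕ → ℕ) : T.Sub dep T dep :=
  ⟨subset_rfl, subset_rfl, fun _ => rfl, fun _ _ => rfl, fun _ _ => subset_rfl⟩

theorem Sub.trans {T₁ T₂ T₃ : SeqTree} {d₁ d₂ d₃ : ℕ → ℕ} (h : T₁.Sub d₁ T₂ d₂)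
    (h' : T₂.Sub d₂ T₃ d₃) : T₁.Sub d₁ T₃ d₃ where
  verts := h.verts.trans h'.verts
  edges := h.edges.trans h'.edges
  elabel he := (h'.elabel (h.edges he)).trans (h.elabel he)
  dep v hv := (h'.dep v (h.verts hv)).trans (h.dep v hv)
  ant v hv := (h.ant v hv).trans (h'.ant v (h.verts hv))

theorem Reach.sub {T T' : SeqTree} {d d' : ℕ → ℕ} (hs : T.Sub d T' d') {ct cb x : Bool}
    {w u : ℕ} (h : T.Reach ct cb x w u) : T'.Reach ct cb x w u := by
  rcases h with h | h | ⟨h₁, h₂, h₃⟩ | ⟨h₁, h | h⟩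
  · exact .inl ⟨hs.edges h.1, (hs.elabel h.1).trans h.2⟩
  · exact .inr (.inl ⟨hs.edges h.1, (hs.elabel h.1).trans h.2⟩)
  · exact .inr (.inr (.inl ⟨h₁, h₂, hs.verts h₃⟩))
  · exact .inr (.inr (.inr ⟨h₁, .inl ⟨hs.edges h.1, (hs.elabel h.1).trans h.2⟩⟩))
  · exact .inr (.inr (.inr ⟨h₁, .inr ⟨hs.edges h.1, (hs.elabel h.1).trans h.2⟩⟩))

theorem Graded.reach {S : Finset Fml} {m : ℕ} {T : SeqTree} {dep : ℕ → ℕ}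
    (h : T.Graded S m dep) {ct cb x : Bool} {w u : ℕ} (hr : T.Reach ct cb x w u) :
    dep u ≤ dep w + 1 := by
  rcases hr with hr | hr | ⟨-, rfl, -⟩ | ⟨-, hr | hr⟩
  · exact (h.edge hr.1).le
  · have := h.edge hr.1; omega
  · omega
  · exact (h.edge hr.1).le
  · have := h.edge hr.1; omega

theorem Graded.relabel {S : Finset Fml} {m : ℕ} {T : SeqTree} {dep : ℕ → ℕ}
    (h : T.Graded S m dep) {l : ℕ → GSeq} (hl : ∀ v ∈ T.verts, Fits S m (dep v) (l v)) :
    (T.relabel l).Graded S m dep :=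
  ⟨h.edge, h.le, hl⟩

theorem Graded.addChild {S : Finset Fml} {m : ℕ} {T : SeqTree} {dep : ℕ → ℕ}
    (h : T.Graded S m dep) {w u : ℕ} {x : Bool} (hw : w ∈ T.verts) (hu : u ∉ T.verts)
    (hm : dep w < m) {l : ℕ → GSeq} (hl : ∀ v ∈ T.verts, Fits S m (dep v) (l v))
    (hlu : Fits S m (dep w + 1) (l u)) :
    (T.addChild w u x hw hu l).Graded S m (Function.update dep u (dep w + 1)) := by
  have hne : ∀ v ∈ T.verts, v ≠ u := fun v hv e => hu (e ▸ hv)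
  refine ⟨?_, ?_, ?_⟩
  · intro a b hab
    rcases Finset.mem_insert.1 hab with hab | hab
    · obtain ⟨rfl, rfl⟩ := Prod.mk.inj hab
      simp [hne _ hw]
    · have := T.edges_sub _ hab
      simp [hne _ this.1, hne _ this.2, h.edge hab]
  · intro v hv
    rcases Finset.mem_insert.1 hv with rfl | hv
    · simpa using hm
    · simpa [hne v hv] using h.le v hv
  · intro v hv
    rcases Finset.mem_insert.1 hv with rfl | hv
    · simpa [SeqTree.addChild] using hlu
    · simpa [SeqTree.addChild, hne v hv] using hl v hv

theorem Sub.relabel (T : SeqTree) (dep : ℕ → ℕ) {l : ℕ → GSeq}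
    (hl : ∀ v ∈ T.verts, T.ant v ⊆ (l v).1) : T.Sub dep (T.relabel l) dep :=
  ⟨subset_rfl, subset_rfl, fun _ => rfl, fun _ _ => rfl, hl⟩

theorem Sub.addChild (T : SeqTree) (dep : ℕ → ℕ) {w u : ℕ} {x : Bool} (hw : w ∈ T.verts)
    (hu : u ∉ T.verts) (k : ℕ) {l : ℕ → GSeq} (hl : ∀ v ∈ T.verts, T.ant v ⊆ (l v).1) :
    T.Sub dep (T.addChild w u x hw hu l) (Function.update dep u k) where
  verts := Finset.subset_insert _ _
  edges := Finset.subset_insert _ _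
  elabel {a b} hab := by
    have hb : b ≠ u := fun e => hu (e ▸ (T.edges_sub _ hab).2)
    simp [SeqTree.addChild, hb]
  dep v hv := Function.update_of_ne (ne_of_mem_of_not_mem hv hu) _ _
  ant := hl

/-! ### The saturation measure -/

/-- A property that a component of a seq-tree can acquire during saturation: `inl (b, A)` stands
for `A` occurring in its antecedent (`b = true`) or consequent (`b = false`), and `inr (x, a)`
for having an `x`-child whose antecedent contains `a`. -/
abbrev Feature : Type := (Bool × Fml) ⊕ (Bool × Option Fml)

/-- The component `w` of `T` has the given feature. -/
def Has (T : SeqTree) (w : ℕ) : Feature → Prop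
  | .inl (true, A) => A ∈ T.ant w
  | .inl (false, A) => A ∈ T.suc w
  | .inr (x, a) => ∃ v, (w, v) ∈ T.edges ∧ T.elabel w v = x ∧ ∀ A ∈ a, A ∈ T.ant v

/-- The features built from formulae of `S`. -/
def features (S : Finset Fml) : Finset Feature :=
  (Finset.univ ×ˢ S).disjSum (Finset.univ ×ˢ Finset.insertNone S)

open Classical in
/-- The number of features that `w` lacks. -/
noncomputable def lack (S : Finset Fml) (T : SeqTree) (w : ℕ) : ℕ :=
  ((features S).filter fun f => ¬ T.Has w f).card

/-- The weight of a missing feature at depth `k`. -/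
def weight (S : Finset Fml) (m k : ℕ) : ℕ := ((features S).card + 1) ^ (m - k)

/-- The saturation measure: the weighted number of missing features. -/
noncomputable def potential (S : Finset Fml) (m : ℕ) (T : SeqTree) (dep : ℕ → ℕ) : ℕ :=
  ∑ v ∈ T.verts, lack S T v * weight S m (dep v)

theorem weight_pos (S : Finset Fml) (m k : ℕ) : 0 < weight S m k :=
  Nat.pow_pos (Nat.succ_pos _)

theorem lack_le_card (S : Finset Fml) (T : SeqTree) (w : ℕ) : lack S T w ≤ (features S).card := by
  classical exact Finset.card_filter_le _ _

/-- `T'` extends `T`, labels included. -/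
structure Ext (T : SeqTree) (dep : ℕ → ℕ) (T' : SeqTree) (dep' : ℕ → ℕ) : Prop
    extends T.Sub dep T' dep' where
  suc : ∀ v ∈ T.verts, T.suc v ⊆ T'.suc v

theorem Ext.refl (T : SeqTree) (dep : ℕ → ℕ) : T.Ext dep T dep :=
  ⟨.refl T dep, fun _ _ => subset_rfl⟩

theorem Ext.trans {T₁ T₂ T₃ : SeqTree} {d₁ d₂ d₃ : ℕ → ℕ} (h : T₁.Ext d₁ T₂ d₂)
    (h' : T₂.Ext d₂ T₃ d₃) : T₁.Ext d₁ T₃ d₃ :=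
  ⟨h.toSub.trans h'.toSub, fun v hv => (h.suc v hv).trans (h'.suc v (h.verts hv))⟩

theorem Ext.has {T T' : SeqTree} {d d' : ℕ → ℕ} (h : T.Ext d T' d') {v : ℕ} (hv : v ∈ T.verts)
    {f : Feature} (hf : T.Has v f) : T'.Has v f := by
  match f, hf with
  | .inl (true, A), hf => exact h.ant v hv hf
  | .inl (false, A), hf => exact h.suc v hv hf
  | .inr (x, a), ⟨u, hu, hx, ha⟩ =>
    exact ⟨u, h.edges hu, (h.elabel hu).trans hx,
      fun A hA => h.ant u (T.edges_sub _ hu).2 (ha A hA)⟩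

theorem Ext.lack_le {T T' : SeqTree} {d d' : ℕ → ℕ} (h : T.Ext d T' d') (S : Finset Fml)
    {v : ℕ} (hv : v ∈ T.verts) : lack S T' v ≤ lack S T v := by
  classical
  refine Finset.card_le_card fun f hf => ?_
  simp only [Finset.mem_filter] at hf ⊢
  exact ⟨hf.1, fun hn => hf.2 (h.has hv hn)⟩

theorem Ext.lack_lt {T T' : SeqTree} {d d' : ℕ → ℕ} (h : T.Ext d T' d') {S : Finset Fml}
    {v : ℕ} (hv : v ∈ T.verts) {f : Feature} (hf : f ∈ features S) (hn : ¬ T.Has v f)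
    (hh : T'.Has v f) : lack S T' v < lack S T v := by
  classical
  refine Finset.card_lt_card ((Finset.ssubset_iff_of_subset fun g hg => ?_).2 ⟨f, ?_, ?_⟩)
  · simp only [Finset.mem_filter] at hg ⊢
    exact ⟨hg.1, fun hn => hg.2 (h.has hv hn)⟩
  · simp [hf, hn]
  · simp [hh]

/-- Acquiring a feature at `w` lowers the potential of the old components by the weight of `w`. -/
theorem Ext.sum_add_weight_le {T T' : SeqTree} {d d' : ℕ → ℕ} (h : T.Ext d T' d')
    {S : Finset Fml} (m : ℕ) {w : ℕ} (hw : w ∈ T.verts) {f : Feature} (hf : f ∈ features S)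
    (hn : ¬ T.Has w f) (hh : T'.Has w f) :
    (∑ v ∈ T.verts, lack S T' v * weight S m (d' v)) + weight S m (d w) ≤
      potential S m T d := by
  unfold potential
  rw [← Finset.add_sum_erase _ _ hw, ← Finset.add_sum_erase _ _ hw, h.dep w hw]
  have h₁ : ∑ v ∈ T.verts.erase w, lack S T' v * weight S m (d' v) ≤
      ∑ v ∈ T.verts.erase w, lack S T v * weight S m (d v) := by
    refine Finset.sum_le_sum fun v hv => ?_
    have hv := Finset.mem_of_mem_erase hv
    rw [h.dep v hv]
    exact Nat.mul_le_mul_right _ (h.lack_le S hv)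
  have h₂ : (lack S T' w + 1) * weight S m (d w) ≤ lack S T w * weight S m (d w) :=
    Nat.mul_le_mul_right _ (h.lack_lt hw hf hn hh)
  rw [Nat.succ_mul] at h₂
  omega

end SeqTree

open SeqTree

/-- A saturated unprovable seq-tree: graded, and of minimal potential among its graded unprovable
extensions. -/
structure SatTree (ct cb cd : Bool) (S : Finset Fml) (m : ℕ) : Type where
  T : SeqTree
  dep : ℕ → ℕ
  graded : T.Graded S m dep
  unprov : ¬ Prov ct cb cd T
  minimal : ∀ T' dep', T'.Graded S m dep' → ¬ Prov ct cb cd T' → T.Ext dep T' dep' →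
    potential S m T dep ≤ potential S m T' dep'

namespace SatTree

variable {ct cb cd : Bool} {S : Finset Fml} {m : ℕ}

theorem exists_ext {T : SeqTree} {dep : ℕ → ℕ} (hg : T.Graded S m dep)
    (hp : ¬ Prov ct cb cd T) : ∃ N : SatTree ct cb cd S m, T.Ext dep N.T N.dep := by
  obtain ⟨⟨T', dep'⟩, ⟨hg', hp', he'⟩, hmin⟩ := exists_minimalFor_of_wellFoundedLT
    (fun q : SeqTree × (ℕ → ℕ) => q.1.Graded S m q.2 ∧ ¬ Prov ct cb cd q.1 ∧ T.Ext dep q.1 q.2)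
    (fun q => potential S m q.1 q.2) ⟨(T, dep), hg, hp, .refl T dep⟩
  refine ⟨⟨T', dep', hg', hp', fun T'' dep'' hg'' hp'' he'' => ?_⟩, he'⟩
  by_contra hlt
  exact hlt (hmin (j := (T'', dep'')) ⟨hg'', hp'', he'.trans he''⟩ (not_le.1 hlt).le)

variable (N : SatTree ct cb cd S m) {w : ℕ}

theorem mem_of_ant (hw : w ∈ N.T.verts) {A : Fml} (hA : A ∈ N.T.ant w) :
    A ∈ S ∧ A.mdep + N.dep w ≤ m :=
  N.graded.fits w hw A (Finset.mem_union_left _ hA)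

theorem mem_of_suc (hw : w ∈ N.T.verts) {A : Fml} (hA : A ∈ N.T.suc w) :
    A ∈ S ∧ A.mdep + N.dep w ≤ m :=
  N.graded.fits w hw A (Finset.mem_union_right _ hA)

theorem prov_relabel (hw : w ∈ N.T.verts) {s : GSeq} (h₁ : N.T.ant w ⊆ s.1)
    (h₂ : N.T.suc w ⊆ s.2) (hs : Fits S m (N.dep w) s)
    (hne : ¬ (s.1 ⊆ N.T.ant w ∧ s.2 ⊆ N.T.suc w)) :
    Prov ct cb cd (N.T.relabel (Function.update N.T.vlab w s)) := by
  by_contra hp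
  have hg : (N.T.relabel (Function.update N.T.vlab w s)).Graded S m N.dep := by
    refine N.graded.relabel fun v hv => ?_
    by_cases e : v = w
    · subst e; simpa using hs
    · simpa [e] using N.graded.fits v hv
  have he : N.T.Ext N.dep (N.T.relabel (Function.update N.T.vlab w s)) N.dep := by
    refine ⟨.relabel _ _ fun v hv => ?_, fun v hv => ?_⟩
    · by_cases e : v = w
      · subst e; simpa using h₁
      · simp [e, SeqTree.ant]
    · by_cases e : v = w
      · subst e; simpa [SeqTree.relabel, SeqTree.suc] using h₂
      · simp [e, SeqTree.relabel, SeqTree.suc]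
  have hmin := N.minimal _ _ hg hp he
  suffices ∃ f ∈ features S, ¬ N.T.Has w f ∧
      (N.T.relabel (Function.update N.T.vlab w s)).Has w f by
    obtain ⟨f, hf, hn, hh⟩ := this
    have h₃ := he.sum_add_weight_le m hw hf hn hh
    have h₄ := weight_pos S m (N.dep w)
    have h₅ : potential S m (N.T.relabel (Function.update N.T.vlab w s)) N.dep =
      ∑ v ∈ N.T.verts, lack S (N.T.relabel (Function.update N.T.vlab w s)) v *
        weight S m (N.dep v) := rfl
    omega
  rw [not_and_or, Finset.not_subset, Finset.not_subset] at hne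
  rcases hne with ⟨A, hA, hn⟩ | ⟨A, hA, hn⟩
  · have := (hs A (Finset.mem_union_left _ hA)).1
    exact ⟨.inl (true, A), by simp [features, this], hn,
      by simpa [Has, SeqTree.relabel, SeqTree.ant] using hA⟩
  · have := (hs A (Finset.mem_union_right _ hA)).1
    exact ⟨.inl (false, A), by simp [features, this], hn,
      by simpa [Has, SeqTree.relabel, SeqTree.suc] using hA⟩

theorem prov_addChild (hw : w ∈ N.T.verts) {u : ℕ} (hu : u ∉ N.T.verts) (hm : N.dep w < m)
    {x : Bool} {a : Option Fml} (ha : ∀ A ∈ a, A ∈ S ∧ A.mdep + (N.dep w + 1) ≤ m)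
    (hne : ¬ N.T.Has w (.inr (x, a))) :
    Prov ct cb cd (N.T.addChild w u x hw hu (Function.update N.T.vlab u (a.toFinset, ∅))) := by
  by_contra hp
  have hnu : ∀ v ∈ N.T.verts, v ≠ u := fun v hv e => hu (e ▸ hv)
  set T' := N.T.addChild w u x hw hu (Function.update N.T.vlab u (a.toFinset, ∅)) with hT'
  set d' := Function.update N.dep u (N.dep w + 1) with hd'
  have hg : T'.Graded S m d' := by
    refine N.graded.addChild hw hu hm (fun v hv => ?_) ?_
    · simpa [hnu v hv] using N.graded.fits v hv
    · intro A hA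
      exact ha A (by simpa using hA)
  have he : N.T.Ext N.dep T' d' := by
    refine ⟨.addChild _ _ hw hu _ fun v hv => ?_, fun v hv => ?_⟩
    · simp [hnu v hv, SeqTree.ant]
    · simp [hT', hnu v hv, SeqTree.suc, SeqTree.addChild]
  have hmin := N.minimal _ _ hg hp he
  have hf : (.inr (x, a) : Feature) ∈ features S := by
    cases a with
    | none => simp [features]
    | some A => simp [features, (ha A rfl).1]
  have hh : T'.Has w (.inr (x, a)) := by
    refine ⟨u, Finset.mem_insert_self _ _, ?_, fun A hA => ?_⟩
    · simp [hT', SeqTree.addChild]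
    · simpa [hT', SeqTree.addChild, SeqTree.ant] using hA
  have h₁ := he.sum_add_weight_le m hw hf hne hh
  have h₂ : potential S m T' d' = lack S T' u * weight S m (N.dep w + 1) +
      ∑ v ∈ N.T.verts, lack S T' v * weight S m (d' v) := by
    rw [potential, show T'.verts = insert u N.T.verts from rfl, Finset.sum_insert hu, hd',
      Function.update_self]
  have h₃ : weight S m (N.dep w) = ((features S).card + 1) * weight S m (N.dep w + 1) := by
    rw [weight, weight, ← pow_succ']
    congr 1
    omega
  have h₄ : (lack S T' u + 1) * weight S m (N.dep w + 1) ≤ weight S m (N.dep w) := by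
    rw [h₃]
    exact Nat.mul_le_mul_right _ (Nat.succ_le_succ (lack_le_card S T' u))
  rw [Nat.succ_mul] at h₄
  have h₅ := weight_pos S m (N.dep w + 1)
  omega

/-! ### Saturation conditions -/

/-- `S` is closed under subformulae. -/
def _root_.SubfClosed (S : Finset Fml) : Prop := ∀ A ∈ S, A.subf ⊆ S

theorem fits_insert_ant (hw : w ∈ N.T.verts) {A : Fml} (hA : A ∈ S ∧ A.mdep + N.dep w ≤ m) :
    Fits S m (N.dep w) (insert A (N.T.ant w), N.T.suc w) := by
  intro B hB
  simp only [Finset.insert_union, Finset.mem_insert] at hB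
  rcases hB with rfl | hB
  · exact hA
  · exact N.graded.fits w hw B hB

theorem fits_insert_suc (hw : w ∈ N.T.verts) {A : Fml} (hA : A ∈ S ∧ A.mdep + N.dep w ≤ m) :
    Fits S m (N.dep w) (N.T.ant w, insert A (N.T.suc w)) := by
  intro B hB
  simp only [Finset.union_insert, Finset.mem_insert] at hB
  rcases hB with rfl | hB
  · exact hA
  · exact N.graded.fits w hw B hB

theorem prov_insert_ant (hw : w ∈ N.T.verts) {A : Fml} (hA : A ∈ S ∧ A.mdep + N.dep w ≤ m)
    (hn : A ∉ N.T.ant w) : Prov ct cb cd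
      (N.T.relabel (Function.update N.T.vlab w (insert A (N.T.ant w), N.T.suc w))) :=
  N.prov_relabel hw (Finset.subset_insert _ _) subset_rfl (N.fits_insert_ant hw hA)
    fun h => hn (h.1 (Finset.mem_insert_self _ _))

theorem prov_insert_suc (hw : w ∈ N.T.verts) {A : Fml} (hA : A ∈ S ∧ A.mdep + N.dep w ≤ m)
    (hn : A ∉ N.T.suc w) : Prov ct cb cd
      (N.T.relabel (Function.update N.T.vlab w (N.T.ant w, insert A (N.T.suc w)))) :=
  N.prov_relabel hw subset_rfl (Finset.subset_insert _ _) (N.fits_insert_suc hw hA)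
    fun h => hn (h.2 (Finset.mem_insert_self _ _))

theorem sameShape_relabel (T : SeqTree) (l : ℕ → GSeq) : sameShape T (T.relabel l) :=
  ⟨rfl, rfl, rfl, rfl⟩

theorem updAt_relabel (T : SeqTree) (w : ℕ) (s : GSeq) :
    updAt T w s (T.relabel (Function.update T.vlab w s)) :=
  ⟨sameShape_relabel _ _, rfl⟩

theorem atom_sat (hw : w ∈ N.T.verts) {p : ℕ} (h₁ : Fml.atom p ∈ N.T.ant w) :
    Fml.atom p ∉ N.T.suc w :=
  fun h₂ => N.unprov (.id hw h₁ h₂)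

theorem bot_sat (hw : w ∈ N.T.verts) : Fml.bot ∉ N.T.ant w :=
  fun h => N.unprov (.botL hw h)

theorem or_ant (hS : SubfClosed S) (hw : w ∈ N.T.verts) {A B : Fml} (h : A.or B ∈ N.T.ant w) :
    A ∈ N.T.ant w ∨ B ∈ N.T.ant w := by
  by_contra! hn
  obtain ⟨hs, hd⟩ := N.mem_of_ant hw h
  simp only [Fml.mdep] at hd
  have hA : A ∈ S := hS _ hs (by simp [Fml.subf, Fml.self_mem_subf])
  have hB : B ∈ S := hS _ hs (by simp [Fml.subf, Fml.self_mem_subf])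
  exact N.unprov (.orL ⟨N.T.ant w, hw, (Finset.insert_eq_of_mem h).symm, updAt_relabel _ _ _,
    updAt_relabel _ _ _⟩ (N.prov_insert_ant hw ⟨hA, by omega⟩ hn.1)
    (N.prov_insert_ant hw ⟨hB, by omega⟩ hn.2))

theorem and_suc (hS : SubfClosed S) (hw : w ∈ N.T.verts) {A B : Fml}
    (h : A.and B ∈ N.T.suc w) : A ∈ N.T.suc w ∨ B ∈ N.T.suc w := by
  by_contra! hn
  obtain ⟨hs, hd⟩ := N.mem_of_suc hw h
  simp only [Fml.mdep] at hd
  have hA : A ∈ S := hS _ hs (by simp [Fml.subf, Fml.self_mem_subf])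
  have hB : B ∈ S := hS _ hs (by simp [Fml.subf, Fml.self_mem_subf])
  exact N.unprov (.andR ⟨N.T.suc w, hw, (Finset.insert_eq_of_mem h).symm, updAt_relabel _ _ _,
    updAt_relabel _ _ _⟩ (N.prov_insert_suc hw ⟨hA, by omega⟩ hn.1)
    (N.prov_insert_suc hw ⟨hB, by omega⟩ hn.2))

theorem imp_ant (hS : SubfClosed S) (hw : w ∈ N.T.verts) {A B : Fml}
    (h : A.imp B ∈ N.T.ant w) : A ∈ N.T.suc w ∨ B ∈ N.T.ant w := by
  by_contra! hn
  obtain ⟨hs, hd⟩ := N.mem_of_ant hw h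
  simp only [Fml.mdep] at hd
  have hA : A ∈ S := hS _ hs (by simp [Fml.subf, Fml.self_mem_subf])
  have hB : B ∈ S := hS _ hs (by simp [Fml.subf, Fml.self_mem_subf])
  exact N.unprov (.impL ⟨N.T.ant w, hw, (Finset.insert_eq_of_mem h).symm, updAt_relabel _ _ _,
    updAt_relabel _ _ _⟩ (N.prov_insert_suc hw ⟨hA, by omega⟩ hn.1)
    (N.prov_insert_ant hw ⟨hB, by omega⟩ hn.2))

theorem or_suc (hS : SubfClosed S) (hw : w ∈ N.T.verts) {A B : Fml}
    (h : A.or B ∈ N.T.suc w) : A ∈ N.T.suc w ∧ B ∈ N.T.suc w := by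
  by_contra hn
  obtain ⟨hs, hd⟩ := N.mem_of_suc hw h
  simp only [Fml.mdep] at hd
  have hA : A ∈ S := hS _ hs (by simp [Fml.subf, Fml.self_mem_subf])
  have hB : B ∈ S := hS _ hs (by simp [Fml.subf, Fml.self_mem_subf])
  refine N.unprov (.orR ⟨N.T.suc w, hw, (Finset.insert_eq_of_mem h).symm, updAt_relabel _ _ _⟩
    (N.prov_relabel hw subset_rfl
      ((Finset.subset_insert _ _).trans (Finset.subset_insert _ _)) ?_ ?_))
  · intro C hC
    simp only [Finset.union_insert, Finset.mem_insert] at hC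
    rcases hC with rfl | rfl | hC
    · exact ⟨hA, by omega⟩
    · exact ⟨hB, by omega⟩
    · exact N.graded.fits w hw C hC
  · exact fun hc => hn ⟨hc.2 (by simp), hc.2 (by simp)⟩

theorem and_ant (hS : SubfClosed S) (hw : w ∈ N.T.verts) {A B : Fml}
    (h : A.and B ∈ N.T.ant w) : A ∈ N.T.ant w ∧ B ∈ N.T.ant w := by
  by_contra hn
  obtain ⟨hs, hd⟩ := N.mem_of_ant hw h
  simp only [Fml.mdep] at hd
  have hA : A ∈ S := hS _ hs (by simp [Fml.subf, Fml.self_mem_subf])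
  have hB : B ∈ S := hS _ hs (by simp [Fml.subf, Fml.self_mem_subf])
  refine N.unprov (.andL ⟨N.T.ant w, hw, (Finset.insert_eq_of_mem h).symm, updAt_relabel _ _ _⟩
    (N.prov_relabel hw ((Finset.subset_insert _ _).trans (Finset.subset_insert _ _))
      subset_rfl ?_ ?_))
  · intro C hC
    simp only [Finset.insert_union, Finset.mem_insert] at hC
    rcases hC with rfl | rfl | hC
    · exact ⟨hA, by omega⟩
    · exact ⟨hB, by omega⟩
    · exact N.graded.fits w hw C hC
  · exact fun hc => hn ⟨hc.1 (by simp), hc.1 (by simp)⟩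

theorem diaF_suc (hS : SubfClosed S) {x : Bool} {A : Fml} {u : ℕ}
    (hr : N.T.Reach ct cb x w u) (h : Fml.diaF x A ∈ N.T.suc w) : A ∈ N.T.suc u := by
  by_contra hn
  obtain ⟨hs, hd⟩ := N.mem_of_suc hr.mem_left h
  rw [Fml.mdep_diaF] at hd
  have := N.graded.reach hr
  exact N.unprov (.diaR ⟨hr.mem_left, hr.mem_right, h, hr, updAt_relabel _ _ _⟩
    (N.prov_insert_suc hr.mem_right ⟨hS _ hs (Fml.mem_subf_diaF x A), by omega⟩ hn))

theorem boxF_ant (hS : SubfClosed S) {x : Bool} {A : Fml} {u : ℕ}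
    (hr : N.T.Reach ct cb x w u) (h : Fml.boxF x A ∈ N.T.ant w) : A ∈ N.T.ant u := by
  by_contra hn
  obtain ⟨hs, hd⟩ := N.mem_of_ant hr.mem_left h
  rw [Fml.mdep_boxF] at hd
  have := N.graded.reach hr
  exact N.unprov (.boxL ⟨hr.mem_left, hr.mem_right, h, hr, updAt_relabel _ _ _⟩
    (N.prov_insert_ant hr.mem_right ⟨hS _ hs (Fml.mem_subf_boxF x A), by omega⟩ hn))

theorem diaF_ant (hS : SubfClosed S) (hw : w ∈ N.T.verts) {x : Bool} {A : Fml}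
    (h : Fml.diaF x A ∈ N.T.ant w) : ∃ u, N.T.Reach ct cb x w u ∧ A ∈ N.T.ant u := by
  suffices N.T.Has w (.inr (x, some A)) by
    obtain ⟨u, hu, hx, hA⟩ := this
    exact ⟨u, .inl ⟨hu, hx⟩, hA A rfl⟩
  by_contra hn
  obtain ⟨hs, hd⟩ := N.mem_of_ant hw h
  rw [Fml.mdep_diaF] at hd
  obtain ⟨u, hu⟩ := Infinite.exists_notMem_finset N.T.verts
  refine N.unprov (.diaL (T' := N.T.addChild w u x hw hu _)
    ⟨N.T.ant w, hw, hu, (Finset.insert_eq_of_mem h).symm, rfl, rfl, rfl, rfl, ?_⟩ (N.prov_addChild hw hu (by omega) (x := x) (a := some A) ?_ hn))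
  · funext v
    by_cases e : v = u
    · subst e; simp [SeqTree.addChild]
    · by_cases e' : v = w
      · subst e'; simp [SeqTree.addChild, e, SeqTree.ant, SeqTree.suc]
      · simp [SeqTree.addChild, e, e']
  · intro B hB
    obtain rfl : A = B := by simpa using hB
    exact ⟨hS _ hs (Fml.mem_subf_diaF x A), by omega⟩

theorem serial (hd : cd = true) (hw : w ∈ N.T.verts) (hm : N.dep w < m) :
    ∃ u, N.T.Reach ct cb true w u := by
  suffices N.T.Has w (.inr (true, none)) by
    obtain ⟨u, hu, hx, -⟩ := this
    exact ⟨u, .inl ⟨hu, hx⟩⟩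
  by_contra hn
  obtain ⟨u, hu⟩ := Infinite.exists_notMem_finset N.T.verts
  exact N.unprov (.d (T' := N.T.addChild w u true hw hu _) hd ⟨hw, hu, rfl, rfl, rfl, rfl, rfl⟩
    (N.prov_addChild hw hu hm (x := true) (a := none) (by simp) hn))

theorem imp_suc (hS : SubfClosed S) (hw : w ∈ N.T.verts) {A B : Fml}
    (h : A.imp B ∈ N.T.suc w) : ∃ N' : SatTree ct cb cd S m, N.T.Sub N.dep N'.T N'.dep ∧
      A ∈ N'.T.ant w ∧ B ∈ N'.T.suc w := by
  obtain ⟨hs, hd⟩ := N.mem_of_suc hw h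
  simp only [Fml.mdep] at hd
  have hA : A ∈ S := hS _ hs (by simp [Fml.subf, Fml.self_mem_subf])
  have hB : B ∈ S := hS _ hs (by simp [Fml.subf, Fml.self_mem_subf])
  set l : ℕ → GSeq := Function.update (fun v => (N.T.ant v, ∅)) w (insert A (N.T.ant w), {B})
  have hlw : l w = (insert A (N.T.ant w), {B}) := Function.update_self _ _ _
  have hlv : ∀ v, v ≠ w → l v = (N.T.ant v, ∅) := fun v hv => Function.update_of_ne hv _ _
  have hg : (N.T.relabel l).Graded S m N.dep := by
    refine N.graded.relabel fun v hv => ?_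
    by_cases e : v = w
    · subst e
      rw [hlw]
      intro C hC
      simp only [Finset.mem_union, Finset.mem_insert, Finset.mem_singleton] at hC
      rcases hC with (rfl | hC) | rfl
      · exact ⟨hA, by omega⟩
      · exact N.mem_of_ant hv hC
      · exact ⟨hB, by omega⟩
    · rw [hlv v e]
      exact fun C hC => N.mem_of_ant hv (by simpa using hC)
  obtain ⟨N', hN⟩ := exists_ext hg fun hp =>
    N.unprov (.impR ⟨hw, h, sameShape_relabel _ _, hlv, hlw⟩ hp)
  refine ⟨N', (Sub.relabel _ _ fun v _ => ?_).trans hN.toSub, hN.ant w hw ?_, hN.suc w hw ?_⟩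
  · by_cases e : v = w
    · subst e; simp [hlw]
    · simp [hlv v e]
  · simp [SeqTree.ant, SeqTree.relabel, hlw]
  · simp [SeqTree.suc, SeqTree.relabel, hlw]

theorem boxF_suc (hS : SubfClosed S) (hw : w ∈ N.T.verts) {x : Bool} {A : Fml}
    (h : Fml.boxF x A ∈ N.T.suc w) : ∃ N' : SatTree ct cb cd S m, N.T.Sub N.dep N'.T N'.dep ∧
      ∃ u, N'.T.Reach ct cb x w u ∧ A ∈ N'.T.suc u := by
  obtain ⟨hs, hd⟩ := N.mem_of_suc hw h
  rw [Fml.mdep_boxF] at hd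
  obtain ⟨u, hu⟩ := Infinite.exists_notMem_finset N.T.verts
  have hnu : ∀ v ∈ N.T.verts, v ≠ u := fun v hv e => hu (e ▸ hv)
  set l : ℕ → GSeq := Function.update (fun v => (N.T.ant v, ∅)) u (∅, {A})
  have hlu : l u = (∅, {A}) := Function.update_self _ _ _
  have hlv : ∀ v ∈ N.T.verts, l v = (N.T.ant v, ∅) :=
    fun v hv => Function.update_of_ne (hnu v hv) _ _
  have hg : (N.T.addChild w u x hw hu l).Graded S m
      (Function.update N.dep u (N.dep w + 1)) := by
    refine N.graded.addChild hw hu (by omega) (fun v hv => ?_) ?_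
    · rw [hlv v hv]
      exact fun C hC => N.mem_of_ant hv (by simpa using hC)
    · rw [hlu]
      intro C hC
      obtain rfl : C = A := by simpa using hC
      exact ⟨hS _ hs (Fml.mem_subf_boxF x C), by omega⟩
  obtain ⟨N', hN⟩ := exists_ext hg fun hp =>
    N.unprov (.boxR (T' := N.T.addChild w u x hw hu l) ⟨hw, hu, h, rfl, rfl, rfl, rfl, hlv, hlu⟩ hp)
  have hr : (N.T.addChild w u x hw hu l).Reach ct cb x w u :=
    .inl ⟨Finset.mem_insert_self _ _, by simp [SeqTree.addChild]⟩
  refine ⟨N', (Sub.addChild _ _ hw hu _ fun v hv => ?_).trans hN.toSub, u, hr.sub hN.toSub,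
    hN.suc u hr.mem_right ?_⟩
  · simp [hlv v hv]
  · simp [SeqTree.suc, SeqTree.addChild, hlu]

end SatTree

/-- A world of the canonical model: a component of a saturated unprovable seq-tree. -/
structure CanWorld (ct cb cd : Bool) (S : Finset Fml) (m : ℕ) : Type where
  tree : SatTree ct cb cd S m
  pt : ℕ
  mem : pt ∈ tree.T.verts

namespace CanWorld

variable {ct cb cd : Bool} {S : Finset Fml} {m : ℕ}

/-- The order of the canonical model. -/
def le (p q : CanWorld ct cb cd S m) : Prop :=
  p.tree.T.Sub p.tree.dep q.tree.T q.tree.dep ∧ p.pt = q.pt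

/-- The accessibility relations of the canonical model in both directions; if `D ∈ C`, the
components of depth `m` are related to themselves. -/
def acc (x : Bool) (p q : CanWorld ct cb cd S m) : Prop :=
  p.tree = q.tree ∧ (p.tree.T.Reach ct cb x p.pt q.pt ∨
    (cd = true ∧ p.pt = q.pt ∧ p.tree.dep p.pt = m))

theorem acc.swap {x : Bool} {p q : CanWorld ct cb cd S m} (h : acc x p q) : acc (!x) q p := by
  obtain ⟨N, w, hw⟩ := p
  obtain ⟨N', u, hu⟩ := q
  obtain ⟨rfl, h | ⟨h₁, h₂, h₃⟩⟩ := h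
  · exact ⟨rfl, .inl h.swap⟩
  · exact ⟨rfl, .inr ⟨h₁, h₂.symm, h₂ ▸ h₃⟩⟩

theorem acc.lift {x : Bool} {p p' q : CanWorld ct cb cd S m} (hle : p.le p') (h : acc x p q) :
    ∃ q', acc x p' q' ∧ q.le q' := by
  obtain ⟨N, w, hw⟩ := p
  obtain ⟨N₁, u, hu⟩ := q
  obtain ⟨N', w', hw'⟩ := p'
  obtain ⟨hs, rfl⟩ := hle
  obtain ⟨rfl, h⟩ := h
  refine ⟨⟨N', u, hs.verts hu⟩, ⟨rfl, ?_⟩, hs, rfl⟩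
  rcases h with h | ⟨h₁, h₂, h₃⟩
  · exact .inl (h.sub hs)
  · exact .inr ⟨h₁, h₂, (hs.dep _ hw).trans h₃⟩

end CanWorld

open CanWorld in
/-- The canonical model. -/
def canModel (ct cb cd : Bool) (S : Finset Fml) (m : ℕ)
    (hne : Nonempty (CanWorld ct cb cd S m)) : Model where
  W := CanWorld ct cb cd S m
  le := le
  R := acc true
  val p a := Fml.atom a ∈ p.tree.T.ant p.pt
  nonempty := hne
  le_refl p := ⟨.refl _ _, rfl⟩
  le_trans h h' := ⟨h.1.trans h'.1, h.2.trans h'.2⟩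
  F1 hle h := h.lift hle
  F2 h hle := by
    obtain ⟨q, hq, hle'⟩ := h.swap.lift hle
    exact ⟨q, hle', hq.swap⟩
  mono {p q a} hle h := hle.2 ▸ hle.1.ant _ p.mem h

section canModel

variable {ct cb cd : Bool} {S : Finset Fml} {m : ℕ} {hne : Nonempty (CanWorld ct cb cd S m)}

theorem canModel_inClass : (canModel ct cb cd S m hne).InClass ct cb cd := by
  refine ⟨?_, ?_, ?_⟩
  · exact fun h p => ⟨rfl, .inl (.inr (.inr (.inl ⟨h, rfl, CanWorld.mem p⟩)))⟩
  · rintro rfl ⟨N, w, hw⟩ ⟨N', u, hu⟩ ⟨rfl, h | ⟨h₁, h₂, h₃⟩⟩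
    · exact ⟨rfl, .inl h.symm⟩
    · exact ⟨rfl, .inr ⟨h₁, h₂.symm, h₂ ▸ h₃⟩⟩
  · rintro h ⟨N, w, hw⟩
    rcases (N.graded.le w hw).lt_or_eq with hm | hm
    · obtain ⟨u, hu⟩ := N.serial h hw hm
      exact ⟨⟨N, u, hu.mem_right⟩, rfl, .inl hu⟩
    · exact ⟨⟨N, w, hw⟩, rfl, .inr ⟨h, rfl, hm⟩⟩

theorem acc_false_iff {p q : CanWorld ct cb cd S m} :
    CanWorld.acc false p q ↔ CanWorld.acc true q p :=
  ⟨fun h => h.swap, fun h => h.swap⟩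

theorem sat_diaF {x : Bool} {A : Fml} {p : CanWorld ct cb cd S m} :
    (canModel ct cb cd S m hne).Sat p (.diaF x A) ↔
      ∃ q : CanWorld ct cb cd S m, CanWorld.acc x p q ∧ (canModel ct cb cd S m hne).Sat q A := by
  cases x
  · simp only [acc_false_iff]; rfl
  · rfl

theorem sat_boxF {x : Bool} {A : Fml} {p : CanWorld ct cb cd S m} :
    (canModel ct cb cd S m hne).Sat p (.boxF x A) ↔
      ∀ p' q : CanWorld ct cb cd S m, p.le p' → CanWorld.acc x p' q →
        (canModel ct cb cd S m hne).Sat q A := by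
  cases x
  · simp only [acc_false_iff]; rfl
  · rfl

/-- Formulae in the antecedent of a world hold there, those in the consequent fail. -/
def Truth (hne : Nonempty (CanWorld ct cb cd S m)) (A : Fml) : Prop :=
  ∀ p : CanWorld ct cb cd S m,
    (A ∈ p.tree.T.ant p.pt → (canModel ct cb cd S m hne).Sat p A) ∧
    (A ∈ p.tree.T.suc p.pt → ¬ (canModel ct cb cd S m hne).Sat p A)

theorem Truth.diaF (hS : SubfClosed S) {A : Fml} (hA : Truth hne A) (x : Bool) :
    Truth hne (.diaF x A) := by
  rintro ⟨N, w, hw⟩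
  simp only [sat_diaF]
  refine ⟨fun h => ?_, ?_⟩
  · obtain ⟨u, hu, hAu⟩ := N.diaF_ant hS hw h
    exact ⟨⟨N, u, hu.mem_right⟩, ⟨rfl, .inl hu⟩, (hA _).1 hAu⟩
  · rintro h ⟨⟨N', u, hu⟩, ⟨rfl, hr | ⟨-, -, hm⟩⟩, hsat⟩
    · exact (hA _).2 (N.diaF_suc hS hr h) hsat
    · have hd := (N.mem_of_suc hw h).2
      rw [Fml.mdep_diaF] at hd
      replace hm : N.dep w = m := hm
      omega

theorem Truth.boxF (hS : SubfClosed S) {A : Fml} (hA : Truth hne A) (x : Bool) :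
    Truth hne (.boxF x A) := by
  rintro ⟨N, w, hw⟩
  simp only [sat_boxF]
  refine ⟨?_, fun h hsat => ?_⟩
  · rintro h ⟨N₁, w₁, hw₁⟩ ⟨N₂, u, hu⟩ ⟨hs, rfl⟩ ⟨rfl, hr | ⟨-, -, hm⟩⟩
    · exact (hA _).1 (N₁.boxF_ant hS hr (hs.ant w hw h))
    · have hd := (N₁.mem_of_ant hw₁ (hs.ant w hw h)).2
      replace hd : A.mdep + 1 + N₁.dep w ≤ m := Fml.mdep_boxF x A ▸ hd
      replace hm : N₁.dep w = m := hm
      omega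
  · obtain ⟨N', hs, u, hu, hAu⟩ := N.boxF_suc hS hw h
    exact (hA ⟨N', u, hu.mem_right⟩).2 hAu
      (hsat ⟨N', w, hs.verts hw⟩ _ ⟨hs, rfl⟩ ⟨rfl, .inl hu⟩)

theorem truth (hS : SubfClosed S) (A : Fml) : Truth hne A := by
  induction A with
  | atom a => exact fun p => ⟨id, fun h₁ h₂ => p.tree.atom_sat p.mem h₂ h₁⟩
  | bot => exact fun p => ⟨fun h => (p.tree.bot_sat p.mem h).elim, fun _ => id⟩
  | or A B ihA ihB =>
    refine fun p => ⟨fun h => (p.tree.or_ant hS p.mem h).imp (ihA p).1 (ihB p).1, fun h => ?_⟩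
    have := p.tree.or_suc hS p.mem h
    exact not_or.2 ⟨(ihA p).2 this.1, (ihB p).2 this.2⟩
  | and A B ihA ihB =>
    refine fun p => ⟨fun h => (p.tree.and_ant hS p.mem h).imp (ihA p).1 (ihB p).1, fun h => ?_⟩
    exact not_and_or.2 ((p.tree.and_suc hS p.mem h).imp (ihA p).2 (ihB p).2)
  | imp A B ihA ihB =>
    rintro ⟨N, w, hw⟩
    refine ⟨?_, fun h hsat => ?_⟩
    · rintro h ⟨N', w', hw'⟩ ⟨hs, rfl⟩ hA
      rcases N'.imp_ant hS hw' (hs.ant w hw h) with h' | h'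
      · exact absurd hA ((ihA _).2 h')
      · exact (ihB _).1 h'
    · obtain ⟨N', hs, hA, hB⟩ := N.imp_suc hS hw h
      exact (ihB ⟨N', w, hs.verts hw⟩).2 hB
        (hsat ⟨N', w, hs.verts hw⟩ ⟨hs, rfl⟩ ((ihA ⟨N', w, hs.verts hw⟩).1 hA))
  | dia A ih => exact ih.diaF hS true
  | bdia A ih => exact ih.diaF hS false
  | box A ih => exact ih.boxF hS true
  | bbox A ih => exact ih.boxF hS false

end canModel

/-- Theorem 3.7, completeness: if `A` is valid on all frames in
`F_C`, then the nested sequent `⊢ A` is provable in `NIK_tC`. -/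
theorem nested_completeness (ct cb cd : Bool) (A : Fml)
    (h : ∀ M : Model, M.InClass ct cb cd → ∀ w : M.W, M.Sat w A) :
    Prov ct cb cd (singleSeq A) := by
  by_contra hp
  have hg : (singleSeq A).Graded A.subf A.mdep (fun _ => 0) := by
    refine ⟨fun h => ?_, fun _ _ => Nat.zero_le _, fun v _ B hB => ?_⟩
    · simp [singleSeq] at h
    · obtain rfl : B = A := by simpa [singleSeq] using hB
      exact ⟨B.self_mem_subf, le_rfl⟩
  obtain ⟨N, hN⟩ := SatTree.exists_ext hg hp
  have h0 : 0 ∈ (singleSeq A).verts := Finset.mem_singleton_self 0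
  let p : CanWorld ct cb cd A.subf A.mdep := ⟨N, 0, hN.verts h0⟩
  exact (truth (hne := ⟨p⟩) (fun _ => Fml.subf_subset) A p).2
    (hN.suc 0 h0 (Finset.mem_singleton_self A)) (h _ canModel_inClass p)
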